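/- arXiv:1701.05000 — 2 statements merged into one kernel-verified Lean document; each statement's English description precedes it below -/
import Mathlib

section
/- Let (X,d) be a metric space and let p, x, q ∈ X with x ≠ p and x ≠ q. Assume that: (i) the two-sided limit L := lim_{ε→0} (lip(r_p + ε r_q)²(x) − lip(r_p)²(x))/(2ε) exists; (ii) there exist geodesics γ^{xp}, γ^{xq} : [0,1] → X with γ^{xp}_0 = γ^{xq}_0 = x, γ^{xp}_1 = p, γ^{xq}_1 = q. Then the limit lim_{t↓0} (d(q, γ^{xp}_t) − d(q, x))/t exists and equals −d(p,x)·L; in other words, the angle between the geodesics γ^{xp} and γ^{xq} at x exists and its cosine equals L. -/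
open Filter Topology Metric Set

open scoped Classical in
/-- The local Lipschitz constant (slope) of `f` at `x`:
`limsup_{y → x} |f y − f x| / dist y x` if `x` is not isolated, `0` otherwise. -/
noncomputable def locLip {X : Type*} [MetricSpace X] (f : X → ℝ) (x : X) : ℝ :=
  if (𝓝[≠] x).NeBot then
    Filter.limsup (fun y => |f y - f x| / dist y x) (𝓝[≠] x)
  else 0

/-- A constant-speed geodesic parametrized on `[0,1]`:
`dist (γ s) (γ t) = |s − t| * dist (γ 0) (γ 1)` for all `s, t ∈ [0,1]`. -/
def IsGeodesic {X : Type*} [MetricSpace X] (γ : ℝ → X) : Prop :=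
  ∀ s ∈ Set.Icc (0:ℝ) 1, ∀ t ∈ Set.Icc (0:ℝ) 1,
    dist (γ s) (γ t) = |s - t| * dist (γ 0) (γ 1)

/-- `γ` represents the gradient of `f` at time 0:
`liminf_{t↓0} (f(γ t) − f(γ 0))/t ≥ ½ lip f(γ 0)² + ½ |γ̇|²`,
where `|γ̇| = dist (γ 0) (γ 1)` is the speed of the geodesic. -/
noncomputable def RepresentsGradAtZero {X : Type*} [MetricSpace X]
    (f : X → ℝ) (γ : ℝ → X) : Prop :=
  (1/2) * locLip f (γ 0) ^ 2 + (1/2) * dist (γ 0) (γ 1) ^ 2 ≤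
    Filter.liminf (fun t : ℝ => (f (γ t) - f (γ 0)) / t) (𝓝[>] (0:ℝ))

/-- For every `c > locLip f x`, the difference quotients of a Lipschitz function `f` are eventually
below `c` along any curve converging to `x` and avoiding it. -/
theorem eventually_slope_lt_of_locLip_lt {X ι : Type*} [MetricSpace X] {f : X → ℝ} {x : X}
    {K c : ℝ} (hf : ∀ y, |f y - f x| ≤ K * dist y x) (hc : locLip f x < c)
    {l : Filter ι} [l.NeBot] {γ : ι → X} (hγ : Tendsto γ l (𝓝[≠] x)) :
    ∀ᶠ t in l, |f (γ t) - f x| / dist (γ t) x < c := by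
  have hne : (𝓝[≠] x).NeBot := hγ.neBot
  rw [locLip, if_pos hne] at hc
  refine hγ.eventually (eventually_lt_of_limsup_lt hc ?_)
  refine isBoundedUnder_of_eventually_le (a := K) ?_
  filter_upwards [self_mem_nhdsWithin] with y hy
  exact (div_le_iff₀ (dist_pos.2 hy)).2 (hf y)

theorem locLip_le {X : Type*} [MetricSpace X] {f : X → ℝ} {x : X} {K : ℝ} (hK : 0 ≤ K)
    (hf : ∀ y, |f y - f x| ≤ K * dist y x) : locLip f x ≤ K := by
  rw [locLip]
  split_ifs with hne
  · refine limsup_le_of_le ?_ ?_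
    · exact IsBoundedUnder.isCoboundedUnder_le
        (isBoundedUnder_of ⟨0, fun y => by positivity⟩)
    · filter_upwards [self_mem_nhdsWithin] with y hy
      exact (div_le_iff₀ (dist_pos.2 hy)).2 (hf y)
  · exact hK

theorem abs_dist_sub_dist_le {X : Type*} [MetricSpace X] (p x y : X) :
    |dist p y - dist p x| ≤ dist y x := by
  rw [dist_comm p y, dist_comm p x]
  exact abs_dist_sub_le y x p

theorem abs_dist_add_mul_dist_sub_le {X : Type*} [MetricSpace X] (p q x : X) (ε : ℝ) (y : X) :
    |(dist p y + ε * dist q y) - (dist p x + ε * dist q x)| ≤ (1 + |ε|) * dist y x := by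
  have h : (dist p y + ε * dist q y) - (dist p x + ε * dist q x)
      = (dist p y - dist p x) + ε * (dist q y - dist q x) := by ring
  rw [h]
  refine (abs_add_le _ _).trans ?_
  rw [abs_mul, add_mul, one_mul]
  gcongr <;> exact abs_dist_sub_dist_le _ _ _

theorem IsGeodesic.dist_zero {X : Type*} [MetricSpace X] {γ : ℝ → X} (hγ : IsGeodesic γ) {t : ℝ}
    (ht : t ∈ Icc (0 : ℝ) 1) : dist (γ t) (γ 0) = t * dist (γ 0) (γ 1) := by
  rw [hγ t ht 0 (by simp), sub_zero, abs_of_nonneg ht.1]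

theorem IsGeodesic.dist_one {X : Type*} [MetricSpace X] {γ : ℝ → X} (hγ : IsGeodesic γ) {t : ℝ}
    (ht : t ∈ Icc (0 : ℝ) 1) : dist (γ 1) (γ t) = (1 - t) * dist (γ 0) (γ 1) := by
  rw [hγ 1 (by simp) t ht, abs_of_nonneg (sub_nonneg.2 ht.2)]

theorem eventually_mem_Ioc_nhdsGT_zero : ∀ᶠ t : ℝ in 𝓝[>] 0, t ∈ Ioc (0 : ℝ) 1 :=
  Ioc_mem_nhdsGT one_pos

theorem IsGeodesic.tendsto_nhdsNE {X : Type*} [MetricSpace X] {γ : ℝ → X} (hγ : IsGeodesic γ)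
    (hne : γ 0 ≠ γ 1) : Tendsto γ (𝓝[>] 0) (𝓝[≠] (γ 0)) := by
  refine tendsto_nhdsWithin_iff.2 ⟨?_, ?_⟩
  · rw [tendsto_iff_dist_tendsto_zero]
    have h : Tendsto (fun t : ℝ => t * dist (γ 0) (γ 1)) (𝓝[>] 0) (𝓝 0) := by
      have : Tendsto (fun t : ℝ => t * dist (γ 0) (γ 1)) (𝓝 0) (𝓝 (0 * dist (γ 0) (γ 1))) :=
        tendsto_id.mul_const _
      rw [zero_mul] at this
      exact this.mono_left nhdsWithin_le_nhds
    refine h.congr' ?_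
    filter_upwards [eventually_mem_Ioc_nhdsGT_zero] with t ht
    exact (hγ.dist_zero ⟨ht.1.le, ht.2⟩).symm
  · filter_upwards [eventually_mem_Ioc_nhdsGT_zero] with t ht
    refine dist_pos.1 ?_
    rw [hγ.dist_zero ⟨ht.1.le, ht.2⟩]
    exact mul_pos ht.1 (dist_pos.2 hne)

/-- The perturbed slope bounds the difference quotients of `dist q` along a geodesic to `p`. -/
theorem IsGeodesic.eventually_one_sub_lt {X : Type*} [MetricSpace X] {γ : ℝ → X}
    (hγ : IsGeodesic γ) (hne : γ 0 ≠ γ 1) (q : X) {ε c : ℝ}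
    (hc : locLip (fun y => dist (γ 1) y + ε * dist q y) (γ 0) < c) :
    ∀ᶠ t in 𝓝[>] (0 : ℝ),
      1 - ε * ((dist q (γ t) - dist q (γ 0)) / t / dist (γ 0) (γ 1)) < c := by
  have hD : 0 < dist (γ 0) (γ 1) := dist_pos.2 hne
  filter_upwards [eventually_mem_Ioc_nhdsGT_zero, eventually_slope_lt_of_locLip_lt
    (abs_dist_add_mul_dist_sub_le (γ 1) q (γ 0) ε) hc (hγ.tendsto_nhdsNE hne)] with t ht h
  refine lt_of_le_of_lt ?_ h
  have ht0 := ht.1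
  rw [hγ.dist_zero ⟨ht.1.le, ht.2⟩, hγ.dist_one ⟨ht.1.le, ht.2⟩, dist_comm (γ 1) (γ 0),
    le_div_iff₀ (mul_pos ht0 hD)]
  refine le_trans (le_of_eq ?_) (neg_le_abs _)
  field_simp
  ring

theorem IsGeodesic.locLip_dist {X : Type*} [MetricSpace X] {γ : ℝ → X} (hγ : IsGeodesic γ)
    (hne : γ 0 ≠ γ 1) : locLip (fun y => dist (γ 1) y) (γ 0) = 1 := by
  refine le_antisymm (locLip_le zero_le_one fun y => ?_) (le_of_forall_gt fun c hc => ?_)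
  · simpa using abs_dist_sub_dist_le (γ 1) (γ 0) y
  · obtain ⟨t, ht⟩ :=
      (hγ.eventually_one_sub_lt hne (γ 0) (ε := 0) (c := c) (by simpa using hc)).exists
    simpa using ht

/-- A first-order upper bound for a function, from the derivative of its square. -/
theorem eventually_le_of_tendsto_sq_sub_div {F : ℝ → ℝ} {L δ : ℝ} (hδ : 0 < δ)
    (hF : Tendsto (fun ε => (F ε ^ 2 - 1) / (2 * ε)) (𝓝[≠] 0) (𝓝 L)) :
    ∀ᶠ ε in 𝓝[≠] (0 : ℝ), F ε ≤ 1 + ε * L + |ε| * δ := by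
  have hpos : ∀ᶠ ε in 𝓝[≠] (0 : ℝ), 0 < 1 + ε * L + |ε| * δ := by
    have hcont : Continuous fun ε : ℝ => 1 + ε * L + |ε| * δ := by fun_prop
    refine (hcont.tendsto 0).mono_left nhdsWithin_le_nhds |>.eventually (lt_mem_nhds ?_)
    simp
  filter_upwards [hpos, self_mem_nhdsWithin, Metric.tendsto_nhds.1 hF δ hδ] with ε h0 hε h
  have hε : ε ≠ 0 := hε
  refine le_of_abs_le (abs_le_of_sq_le_sq ?_ h0.le)
  rw [Real.dist_eq] at h
  have hsq : F ε ^ 2 = 1 + 2 * (ε * L + ε * ((F ε ^ 2 - 1) / (2 * ε) - L)) := by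
    field_simp
    ring
  have herr : ε * ((F ε ^ 2 - 1) / (2 * ε) - L) ≤ |ε| * δ := by
    refine (le_abs_self _).trans ?_
    rw [abs_mul]
    gcongr
  nlinarith [sq_nonneg (ε * L + |ε| * δ)]

/-- If the angle `∠pxq` exists (as the two-sided limit `L` of the
difference quotients of squared slopes of `r_p + ε r_q`) and geodesics from `x`
to `p` and from `x` to `q` exist, then `lim_{t↓0} (d(q, γ^{xp}_t) − d(q,x))/t`
exists and equals `−d(p,x)·L`. -/
theorem stmt1 {X : Type*} [MetricSpace X] (p x q : X) (hxp : x ≠ p) (hxq : x ≠ q)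
    (L : ℝ)
    (hL : Filter.Tendsto
      (fun ε : ℝ =>
        (locLip (fun y => dist p y + ε * dist q y) x ^ 2
          - locLip (fun y => dist p y) x ^ 2) / (2 * ε))
      (𝓝[≠] (0:ℝ)) (𝓝 L))
    (γp γq : ℝ → X) (hγp : IsGeodesic γp) (hγq : IsGeodesic γq)
    (hγp0 : γp 0 = x) (hγp1 : γp 1 = p) (hγq0 : γq 0 = x) (hγq1 : γq 1 = q) :
    Filter.Tendsto (fun t : ℝ => (dist q (γp t) - dist q x) / t)
      (𝓝[>] (0:ℝ)) (𝓝 (-(dist p x * L))) := by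
  subst hγp0 hγp1
  set D := dist (γp 0) (γp 1) with hDdef
  have hD : 0 < D := dist_pos.2 hxp
  rw [hγp.locLip_dist hxp, one_pow] at hL
  suffices h : Tendsto (fun t : ℝ => (dist q (γp t) - dist q (γp 0)) / t / D)
      (𝓝[>] (0:ℝ)) (𝓝 (-L)) by
    have h' := h.const_mul D
    rw [dist_comm (γp 1) (γp 0), ← mul_neg]
    refine h'.congr fun t => ?_
    field_simp
  refine Metric.tendsto_nhds.2 fun δ hδ => ?_
  have hF := eventually_le_of_tendsto_sq_sub_div (half_pos hδ) hL
  have key : ∀ ε : ℝ, ε ≠ 0 →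
      locLip (fun y => dist (γp 1) y + ε * dist q y) (γp 0) ≤ 1 + ε * L + |ε| * (δ / 2) →
      ∀ᶠ t in 𝓝[>] (0 : ℝ),
        1 - ε * ((dist q (γp t) - dist q (γp 0)) / t / D) < 1 + ε * L + |ε| * δ := by
    intro ε hε h
    refine hγp.eventually_one_sub_lt hxp q (h.trans_lt ?_)
    have := mul_pos (abs_pos.2 hε) hδ
    linarith
  obtain ⟨a, ha, ha0⟩ := ((hF.filter_mono (nhdsGT_le_nhdsNE 0)).and self_mem_nhdsWithin).exists
  obtain ⟨b, hb, hb0⟩ := ((hF.filter_mono (nhdsLT_le_nhdsNE 0)).and self_mem_nhdsWithin).exists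
  have ha0 : 0 < a := ha0
  have hb0 : b < 0 := hb0
  filter_upwards [key a ha0.ne' ha, key b hb0.ne hb] with t h1 h2
  rw [abs_of_pos ha0] at h1
  rw [abs_of_neg hb0] at h2
  rw [Real.dist_eq, abs_lt]
  constructor <;> nlinarith
end

section
/- Let (X,d) be a metric space, let f, g : X → ℝ be Lipschitz, and let γ : [0,1] → X be a geodesic that represents the gradient of f at time 0. Then for every ε > 0 it holds limsup_{t↓0} (g(γ_t) − g(γ_0))/t ≤ (lip(f + εg)²(γ_0) − lip f²(γ_0))/(2ε), and for every ε < 0 it holds liminf_{t↓0} (g(γ_t) − g(γ_0))/t ≥ (lip(f + εg)²(γ_0) − lip f²(γ_0))/(2ε). -/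
open Filter Topology Metric Set

/-- The difference quotients of a Lipschitz function along a geodesic are bounded. -/
theorem IsGeodesic.abs_sub_div_le {X : Type*} [MetricSpace X] {γ : ℝ → X}
    (hγ : IsGeodesic γ) {h : X → ℝ} {K : NNReal} (hh : LipschitzWith K h) :
    ∀ᶠ t in 𝓝[>] (0:ℝ), |(h (γ t) - h (γ 0)) / t| ≤ K * dist (γ 0) (γ 1) := by
  filter_upwards [Ioc_mem_nhdsGT (zero_lt_one' ℝ)] with t ht
  have h1 := hγ t ⟨ht.1.le, ht.2⟩ 0 (by simp)
  have h2 := hh.dist_le_mul (γ t) (γ 0)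
  rw [h1, sub_zero, abs_of_pos ht.1, Real.dist_eq] at h2
  rw [abs_div, abs_of_pos ht.1, div_le_iff₀ ht.1]
  linarith

/-- The difference quotients of a Lipschitz function along a geodesic are asymptotically
bounded by the slope times the speed. -/
theorem IsGeodesic.eventually_sub_div_le {X : Type*} [MetricSpace X] {γ : ℝ → X}
    (hγ : IsGeodesic γ) {h : X → ℝ} {K : NNReal} (hh : LipschitzWith K h)
    {δ : ℝ} (hδ : 0 < δ) :
    ∀ᶠ t in 𝓝[>] (0:ℝ),
      (h (γ t) - h (γ 0)) / t ≤ locLip h (γ 0) * dist (γ 0) (γ 1) + δ := by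
  rcases (dist_nonneg (x := γ 0) (y := γ 1)).eq_or_lt with hD | hD
  · filter_upwards [hγ.abs_sub_div_le hh] with t ht
    rw [← hD, mul_zero] at ht ⊢
    linarith [le_abs_self ((h (γ t) - h (γ 0)) / t)]
  · set D := dist (γ 0) (γ 1)
    have hdist : ∀ᶠ t in 𝓝[>] (0:ℝ), 0 < t ∧ dist (γ t) (γ 0) = t * D := by
      filter_upwards [Ioc_mem_nhdsGT (zero_lt_one' ℝ)] with t ht
      refine ⟨ht.1, ?_⟩
      rw [hγ t ⟨ht.1.le, ht.2⟩ 0 (by simp), sub_zero, abs_of_pos ht.1]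
    have hlim : Tendsto γ (𝓝[>] (0:ℝ)) (𝓝[≠] (γ 0)) := by
      refine tendsto_nhdsWithin_iff.2 ⟨?_, ?_⟩
      · rw [tendsto_iff_dist_tendsto_zero]
        have : Tendsto (fun t : ℝ => t * D) (𝓝[>] (0:ℝ)) (𝓝 0) := by
          have h0 := (continuous_mul_const D).tendsto 0
          rw [zero_mul] at h0
          exact h0.mono_left nhdsWithin_le_nhds
        exact this.congr' (hdist.mono fun t ht => ht.2.symm)
      · filter_upwards [hdist] with t ht
        refine dist_pos.1 ?_
        rw [ht.2]
        exact mul_pos ht.1 hD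
    have hne : (𝓝[≠] (γ 0)).NeBot := hlim.neBot
    have hbdd : IsBoundedUnder (· ≤ ·) (𝓝[≠] (γ 0))
        (fun y => |h y - h (γ 0)| / dist y (γ 0)) := by
      refine isBoundedUnder_of ⟨K, fun y => ?_⟩
      refine div_le_of_le_mul₀ dist_nonneg K.2 ?_
      simpa [Real.dist_eq] using hh.dist_le_mul y (γ 0)
    have hlt : limsup (fun y => |h y - h (γ 0)| / dist y (γ 0)) (𝓝[≠] (γ 0))
        < locLip h (γ 0) + δ / D := by
      rw [locLip, if_pos hne]
      linarith [div_pos hδ hD]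
    filter_upwards [hlim.eventually (eventually_lt_of_limsup_lt hlt hbdd), hdist] with t ht htd
    rw [htd.2, div_lt_iff₀ (mul_pos htd.1 hD)] at ht
    rw [div_le_iff₀ htd.1]
    have h1 : (locLip h (γ 0) + δ / D) * (t * D) = (locLip h (γ 0) * D + δ) * t := by
      field_simp
    linarith [le_abs_self (h (γ t) - h (γ 0))]

/-- Along a geodesic representing the gradient of `f`, the derivative of `ε * g` is
asymptotically controlled by the variation of the squared slope. -/
theorem RepresentsGradAtZero.eventually_mul_le {X : Type*} [MetricSpace X] {f g : X → ℝ}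
    {Kf Kg : NNReal} (hf : LipschitzWith Kf f) (hg : LipschitzWith Kg g)
    {γ : ℝ → X} (hγ : IsGeodesic γ) (hrep : RepresentsGradAtZero f γ) (ε : ℝ)
    {δ : ℝ} (hδ : 0 < δ) :
    ∀ᶠ t in 𝓝[>] (0:ℝ), ε * ((g (γ t) - g (γ 0)) / t) ≤
      (locLip (fun y => f y + ε * g y) (γ 0) ^ 2 - locLip f (γ 0) ^ 2) / 2 + δ := by
  have hh : LipschitzWith (Kf + ‖ε‖₊ * Kg) (fun y => f y + ε * g y) :=
    hf.add ((lipschitzWith_smul ε).comp hg)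
  have hbdd : IsBoundedUnder (· ≥ ·) (𝓝[>] (0:ℝ)) (fun t => (f (γ t) - f (γ 0)) / t) :=
    ⟨_, eventually_map.2 ((hγ.abs_sub_div_le hf).mono fun t ht => (abs_le.1 ht).1)⟩
  have hlow := eventually_lt_of_lt_liminf
    ((sub_lt_self _ (half_pos hδ)).trans_le hrep) hbdd
  filter_upwards [hlow, hγ.eventually_sub_div_le hh (half_pos hδ)] with t h1 h2
  have h3 : (f (γ t) + ε * g (γ t) - (f (γ 0) + ε * g (γ 0))) / t
      = (f (γ t) - f (γ 0)) / t + ε * ((g (γ t) - g (γ 0)) / t) := by ring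
  rw [h3] at h2
  linarith [two_mul_le_add_sq (locLip (fun y => f y + ε * g y) (γ 0)) (dist (γ 0) (γ 1))]

/-- if `γ` represents the gradient of `f` at time 0, then for every
`ε > 0`, `limsup_{t↓0} (g(γ t) − g(γ 0))/t ≤ (lip(f+εg)²(γ 0) − lip f²(γ 0))/(2ε)`,
and for every `ε < 0` the reverse inequality holds with `liminf`. -/
theorem stmt6 {X : Type*} [MetricSpace X] (f g : X → ℝ) (Kf Kg : NNReal)
    (hf : LipschitzWith Kf f) (hg : LipschitzWith Kg g)
    (γ : ℝ → X) (hγ : IsGeodesic γ) (hrep : RepresentsGradAtZero f γ) :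
    (∀ ε : ℝ, 0 < ε →
      Filter.limsup (fun t : ℝ => (g (γ t) - g (γ 0)) / t) (𝓝[>] (0:ℝ))
        ≤ (locLip (fun y => f y + ε * g y) (γ 0) ^ 2 - locLip f (γ 0) ^ 2)
            / (2 * ε)) ∧
    (∀ ε : ℝ, ε < 0 →
      (locLip (fun y => f y + ε * g y) (γ 0) ^ 2 - locLip f (γ 0) ^ 2) / (2 * ε)
        ≤ Filter.liminf (fun t : ℝ => (g (γ t) - g (γ 0)) / t) (𝓝[>] (0:ℝ))) := by
  have hbd := hγ.abs_sub_div_le hg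
  constructor
  · intro ε hε
    refine le_of_forall_pos_le_add fun δ hδ => ?_
    refine limsup_le_of_le (IsBoundedUnder.isCoboundedUnder_le
      ⟨_, eventually_map.2 (hbd.mono fun t ht => (abs_le.1 ht).1)⟩) ?_
    filter_upwards [hrep.eventually_mul_le hf hg hγ ε (mul_pos hε hδ)] with t ht
    refine le_of_mul_le_mul_left (ht.trans_eq ?_) hε
    field_simp
  · intro ε hε
    refine le_of_forall_sub_le fun δ hδ => ?_
    refine le_liminf_of_le (IsBoundedUnder.isCoboundedUnder_ge
      ⟨_, eventually_map.2 (hbd.mono fun t ht => (abs_le.1 ht).2)⟩) ?_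
    filter_upwards [hrep.eventually_mul_le hf hg hγ ε (mul_pos (neg_pos.2 hε) hδ)] with t ht
    refine (mul_le_mul_left_of_neg hε).1 (ht.trans_eq ?_)
    have := hε.ne
    field_simp
    ring
end
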